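/- arXiv:1110.6802 — 11 statements merged into one kernel-verified Lean document; each statement's English description precedes it below -/
import Mathlib

section
/- Let (G,w) be a nonempty connected weighted graph. Then the function ρ_w, defined by ρ_w(x,x) = 0 and ρ_w(x,y) = inf_{P ∈ 𝔓_{x,y}} (max_{e ∈ E(P)} w(e)) for x ≠ y (the infimum over all paths P in G joining x and y), is a pseudoultrametric on V(G). -/
open scoped Classical

open SimpleGraph

/-- A pseudoultrametric on a set `X`. -/
def IsPseudoultrametric {X : Type*} (d : X → X → ℝ) : Prop :=
  (∀ x y, 0 ≤ d x y) ∧ (∀ x, d x x = 0) ∧ (∀ x y, d x y = d y x) ∧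
    ∀ x y z, d x y ≤ max (d x z) (d z y)

/-- An ultrametric on a set `X`. -/
def IsUltrametric {X : Type*} (d : X → X → ℝ) : Prop :=
  IsPseudoultrametric d ∧ ∀ x y, d x y = 0 → x = y

/-- A pseudometric on a set `X`. -/
def IsPseudometric {X : Type*} (d : X → X → ℝ) : Prop :=
  (∀ x y, 0 ≤ d x y) ∧ (∀ x, d x x = 0) ∧ (∀ x y, d x y = d y x) ∧
    ∀ x y z, d x y ≤ d x z + d z y

/-- A metric on a set `X`. -/
def IsMetric {X : Type*} (d : X → X → ℝ) : Prop :=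
  IsPseudometric d ∧ ∀ x y, d x y = 0 → x = y

variable {V : Type*}

/-- `d` extends the weight `w` of the weighted graph `(G, w)`. -/
def ExtendsWeight (G : SimpleGraph V) (w : Sym2 V → ℝ) (d : V → V → ℝ) : Prop :=
  ∀ u v : V, G.Adj u v → d u v = w s(u, v)

/-- The maximal weight of an edge of a walk (`0` for a trivial walk). -/
noncomputable def walkMax {G : SimpleGraph V} (w : Sym2 V → ℝ) {x y : V} (p : G.Walk x y) : ℝ :=
  (p.edges.map w).foldr max 0

/-- The subdominant pseudoultrametric `ρ_w` of a connected weighted graph `(G, w)`. -/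
noncomputable def rho (G : SimpleGraph V) (w : Sym2 V → ℝ) (x y : V) : ℝ :=
  if x = y then 0 else sInf {r : ℝ | ∃ p : G.Walk x y, p.IsPath ∧ r = walkMax w p}

/-- The shortest-path pseudometric `d_w` of a connected weighted graph `(G, w)`. -/
noncomputable def spDist (G : SimpleGraph V) (w : Sym2 V → ℝ) (x y : V) : ℝ :=
  if x = y then 0 else sInf {r : ℝ | ∃ p : G.Walk x y, p.IsPath ∧ r = (p.edges.map w).sum}

theorem foldr_max_lt_iff (l : List ℝ) (c : ℝ) :
    l.foldr max 0 < c ↔ 0 < c ∧ ∀ a ∈ l, a < c := by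
  induction l with
  | nil => simp
  | cons a l ih =>
    simp only [List.foldr_cons, max_lt_iff, ih, List.mem_cons, forall_eq_or_imp]
    tauto

theorem walkMax_lt_iff {G : SimpleGraph V} (w : Sym2 V → ℝ) {x y : V} (p : G.Walk x y) (c : ℝ) :
    walkMax w p < c ↔ 0 < c ∧ ∀ e ∈ p.edges, w e < c := by
  unfold walkMax
  rw [foldr_max_lt_iff]
  simp only [List.mem_map, forall_exists_index, and_imp, forall_apply_eq_imp_iff₂]

theorem walkMax_nonneg {G : SimpleGraph V} (w : Sym2 V → ℝ) {x y : V} (p : G.Walk x y) :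
    0 ≤ walkMax w p := by
  by_contra h
  have h1 := (walkMax_lt_iff w p 0).1 (not_le.1 h)
  exact lt_irrefl _ h1.1

theorem rho_nonneg (G : SimpleGraph V) (w : Sym2 V → ℝ) (x y : V) : 0 ≤ rho G w x y := by
  unfold rho
  split_ifs
  · exact le_rfl
  · apply Real.sInf_nonneg
    rintro r ⟨p, -, rfl⟩
    exact walkMax_nonneg w p

theorem rho_lt_iff (G : SimpleGraph V) (hG : G.Connected) (w : Sym2 V → ℝ) (x y : V) (c : ℝ) :
    rho G w x y < c ↔ 0 < c ∧ ∃ p : G.Walk x y, ∀ e ∈ p.edges, w e < c := by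
  constructor
  · intro h
    refine ⟨(rho_nonneg G w x y).trans_lt h, ?_⟩
    unfold rho at h
    split_ifs at h with hxy
    · subst hxy
      exact ⟨Walk.nil, by simp⟩
    · obtain ⟨q⟩ := hG.preconnected x y
      obtain ⟨r, ⟨p, -, rfl⟩, hr⟩ := exists_lt_of_csInf_lt
        (s := {r : ℝ | ∃ p : G.Walk x y, p.IsPath ∧ r = walkMax w p})
        ⟨_, q.bypass, q.bypass_isPath, rfl⟩ h
      exact ⟨p, ((walkMax_lt_iff w p c).1 hr).2⟩
  · rintro ⟨hc, p, hp⟩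
    unfold rho
    split_ifs with hxy
    · exact hc
    · have hlt : walkMax w p.bypass < c :=
        (walkMax_lt_iff w _ c).2 ⟨hc, fun e he => hp e (p.edges_bypass_subset_edges he)⟩
      refine lt_of_le_of_lt (csInf_le ⟨0, ?_⟩ ⟨p.bypass, p.bypass_isPath, rfl⟩) hlt
      rintro r ⟨q, -, rfl⟩
      exact walkMax_nonneg w q

theorem rho_isPseudoultrametric [Nonempty V] (G : SimpleGraph V) (hG : G.Connected)
    (w : Sym2 V → ℝ) (hw : ∀ e ∈ G.edgeSet, 0 ≤ w e) :
    IsPseudoultrametric (rho G w) := by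
  have symm_le : ∀ x y, rho G w x y ≤ rho G w y x := by
    intro x y
    refine le_of_forall_gt fun c hc => ?_
    rw [rho_lt_iff G hG] at hc ⊢
    obtain ⟨h0, p, hp⟩ := hc
    exact ⟨h0, p.reverse, fun e he => hp e (by simpa using he)⟩
  refine ⟨rho_nonneg G w, fun x => by simp [rho],
    fun x y => le_antisymm (symm_le x y) (symm_le y x), fun x y z => ?_⟩
  refine le_of_forall_gt fun c hc => ?_
  rw [max_lt_iff, rho_lt_iff G hG, rho_lt_iff G hG] at hc
  obtain ⟨⟨h0, p, hp⟩, -, q, hq⟩ := hc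
  refine (rho_lt_iff G hG w x y c).2 ⟨h0, p.append q, fun e he => ?_⟩
  rw [Walk.edges_append, List.mem_append] at he
  exact he.elim (hp e) (hq e)
end

section
/- Let (G,w) be a nonempty connected weighted graph. Then ρ_w is the subdominant pseudoultrametric for w: ρ_w(u,v) ≤ w({u,v}) for every edge {u,v} ∈ E(G), and for every pseudoultrametric ρ on V(G) satisfying ρ(u,v) ≤ w({u,v}) for all edges {u,v} ∈ E(G), one has ρ(x,y) ≤ ρ_w(x,y) for all x,y ∈ V(G). -/
open scoped Classical

open SimpleGraph

variable {V : Type*}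

theorem walkMax_le_iff {G : SimpleGraph V} (w : Sym2 V → ℝ) {x y : V} (p : G.Walk x y) (r : ℝ) :
    walkMax w p ≤ r ↔ 0 ≤ r ∧ ∀ e ∈ p.edges, w e ≤ r := by
  unfold walkMax
  induction p.edges with
  | nil => simp
  | cons a l ih =>
    simp only [List.map_cons, List.foldr_cons, max_le_iff, ih, List.mem_cons, forall_eq_or_imp]
    tauto

theorem rho_le_walkMax {G : SimpleGraph V} (w : Sym2 V → ℝ) {x y : V} (p : G.Walk x y) :
    rho G w x y ≤ walkMax w p := by
  unfold rho
  split_ifs with h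
  · exact walkMax_nonneg w p
  · refine le_trans (b := walkMax w p.bypass)
      (csInf_le ⟨0, ?_⟩ ⟨p.bypass, p.bypass_isPath, rfl⟩) ?_
    · rintro _ ⟨q, _, rfl⟩
      exact walkMax_nonneg w q
    · rw [walkMax_le_iff]
      exact ⟨walkMax_nonneg w p, fun e he =>
        ((walkMax_le_iff w p _).1 le_rfl).2 e (p.edges_bypass_subset he)⟩

theorem le_rho_of_walk {G : SimpleGraph V} (hG : G.Connected) (w : Sym2 V → ℝ) {x y : V} {c : ℝ}
    (h : ∀ p : G.Walk x y, c ≤ walkMax w p) : c ≤ rho G w x y := by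
  unfold rho
  split_ifs with hxy
  · subst hxy
    simpa [walkMax] using h Walk.nil
  · obtain ⟨p⟩ := hG.preconnected x y
    refine le_csInf ⟨_, p.bypass, p.bypass_isPath, rfl⟩ ?_
    rintro _ ⟨q, _, rfl⟩
    exact h q

theorem exists_walk_lt {G : SimpleGraph V} (hG : G.Connected) (w : Sym2 V → ℝ) {x y : V} {c : ℝ}
    (h : rho G w x y < c) : ∃ p : G.Walk x y, walkMax w p < c := by
  by_contra! hc
  exact absurd (le_rho_of_walk hG w hc) (not_le.2 h)

/-- `ρ_w` is the subdominant pseudoultrametric for `w`. -/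
theorem rho_subdominant [Nonempty V] (G : SimpleGraph V) (hG : G.Connected)
    (w : Sym2 V → ℝ) (hw : ∀ e ∈ G.edgeSet, 0 ≤ w e) :
    IsPseudoultrametric (rho G w) ∧
    (∀ u v : V, G.Adj u v → rho G w u v ≤ w s(u, v)) ∧
    ∀ ρ : V → V → ℝ, IsPseudoultrametric ρ →
      (∀ u v : V, G.Adj u v → ρ u v ≤ w s(u, v)) →
      ∀ x y : V, ρ x y ≤ rho G w x y := by
  have hsymm : ∀ x y, rho G w x y ≤ rho G w y x := fun x y =>
    le_rho_of_walk hG w fun p => (rho_le_walkMax w p.reverse).trans (by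
      rw [walkMax_le_iff]
      refine ⟨walkMax_nonneg w p, fun e he => ?_⟩
      rw [Walk.edges_reverse, List.mem_reverse] at he
      exact ((walkMax_le_iff w p _).1 le_rfl).2 e he)
  refine ⟨⟨fun x y => le_rho_of_walk hG w (walkMax_nonneg w), fun x => by simp [rho],
    fun x y => le_antisymm (hsymm x y) (hsymm y x), fun x y z => ?_⟩, fun u v huv => ?_, ?_⟩
  · refine le_of_forall_gt_imp_ge_of_dense fun c hc => ?_
    obtain ⟨p, hp⟩ := exists_walk_lt hG w ((le_max_left _ _).trans_lt hc)
    obtain ⟨q, hq⟩ := exists_walk_lt hG w ((le_max_right _ _).trans_lt hc)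
    refine (rho_le_walkMax w (p.append q)).trans ?_
    have hp' := (walkMax_le_iff w p c).1 hp.le
    have hq' := (walkMax_le_iff w q c).1 hq.le
    rw [walkMax_le_iff]
    refine ⟨hp'.1, fun e he => ?_⟩
    rw [Walk.edges_append, List.mem_append] at he
    exact he.elim (hp'.2 e) (hq'.2 e)
  · refine (rho_le_walkMax w huv.toWalk).trans ?_
    rw [walkMax_le_iff]
    exact ⟨hw _ huv, by simp⟩
  · rintro ρ ⟨_, h0, _, ht⟩ hle x y
    refine le_rho_of_walk hG w fun p => ?_
    induction p with
    | nil => simp [walkMax, h0]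
    | @cons a b c hab q ih =>
      refine (ht a c b).trans ?_
      have : walkMax w (Walk.cons hab q) = max (w s(a, b)) (walkMax w q) := by simp [walkMax]
      rw [this]
      exact max_le_max (hle a b hab) ih
end

section
/- Let (G,w) be a nonempty connected weighted graph. Then ρ_w is the subdominant pseudoultrametric for the shortest-path pseudometric d_w: ρ_w(x,y) ≤ d_w(x,y) for all x,y ∈ V(G), and every pseudoultrametric ρ on V(G) with ρ(x,y) ≤ d_w(x,y) for all x,y satisfies ρ(x,y) ≤ ρ_w(x,y) for all x,y ∈ V(G). -/
open scoped Classical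

open SimpleGraph

variable {V : Type*}

theorem walk_weights_nonneg {G : SimpleGraph V} {w : Sym2 V → ℝ}
    (hw : ∀ e ∈ G.edgeSet, 0 ≤ w e) {x y : V} (p : G.Walk x y) :
    ∀ r ∈ p.edges.map w, 0 ≤ r := by
  intro r hr
  obtain ⟨e, he, rfl⟩ := List.mem_map.1 hr
  exact hw e (p.edges_subset_edgeSet he)

theorem foldr_max_nonneg (l : List ℝ) : 0 ≤ l.foldr max 0 := by
  induction l with
  | nil => simp
  | cons a l ih => exact le_max_of_le_right ih

theorem foldr_max_le_sum (l : List ℝ) (h : ∀ r ∈ l, 0 ≤ r) : l.foldr max 0 ≤ l.sum := by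
  induction l with
  | nil => simp
  | cons a l ih =>
    have h1 := ih (fun r hr => h r (List.mem_cons_of_mem _ hr))
    have h2 : 0 ≤ a := h a (by simp)
    have h3 := foldr_max_nonneg l
    simp only [List.foldr_cons, List.sum_cons]
    exact max_le (by linarith) (by linarith)

theorem le_walkMax_of_edges {G : SimpleGraph V} {w : Sym2 V → ℝ} {ρ : V → V → ℝ}
    (hρ : IsPseudoultrametric ρ) (h : ∀ u v, G.Adj u v → ρ u v ≤ w s(u, v))
    {x y : V} (p : G.Walk x y) : ρ x y ≤ walkMax w p := by
  induction p with
  | nil => simp [walkMax, hρ.2.1]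
  | @cons a b c hab p ih =>
    refine (hρ.2.2.2 a c b).trans ?_
    have : walkMax w (Walk.cons hab p) = max (w s(a, b)) (walkMax w p) := by
      simp [walkMax]
    rw [this]
    exact max_le_max (h _ _ hab) ih

theorem spDist_le_of_adj {G : SimpleGraph V} {w : Sym2 V → ℝ}
    (hw : ∀ e ∈ G.edgeSet, 0 ≤ w e) {u v : V} (h : G.Adj u v) :
    spDist G w u v ≤ w s(u, v) := by
  rw [spDist, if_neg h.ne]
  refine csInf_le ⟨0, ?_⟩ ⟨h.toWalk, ?_, ?_⟩
  · rintro r ⟨p, -, rfl⟩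
    exact List.sum_nonneg (walk_weights_nonneg hw p)
  · simp [h.ne]
  · simp

/-- `ρ_w` is the subdominant pseudoultrametric for the shortest-path
pseudometric `d_w`. -/
theorem rho_subdominant_for_spDist [Nonempty V] (G : SimpleGraph V) (hG : G.Connected)
    (w : Sym2 V → ℝ) (hw : ∀ e ∈ G.edgeSet, 0 ≤ w e) :
    (∀ x y : V, rho G w x y ≤ spDist G w x y) ∧
    ∀ ρ : V → V → ℝ, IsPseudoultrametric ρ →
      (∀ x y : V, ρ x y ≤ spDist G w x y) →
      ∀ x y : V, ρ x y ≤ rho G w x y := by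
  refine ⟨fun x y => ?_, fun ρ hρ hle x y => ?_⟩
  · by_cases hxy : x = y
    · simp [rho, spDist, hxy]
    rw [rho, spDist, if_neg hxy, if_neg hxy]
    obtain ⟨q, hq⟩ := (hG.preconnected x y).exists_isPath
    refine le_csInf ⟨_, q, hq, rfl⟩ ?_
    rintro r ⟨p, hp, rfl⟩
    refine le_trans (csInf_le ⟨0, ?_⟩ ⟨p, hp, rfl⟩)
      (foldr_max_le_sum _ (walk_weights_nonneg hw p))
    rintro r ⟨p, -, rfl⟩
    exact foldr_max_nonneg _
  · by_cases hxy : x = y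
    · simp [rho, hxy, hρ.2.1]
    rw [rho, if_neg hxy]
    obtain ⟨q, hq⟩ := (hG.preconnected x y).exists_isPath
    refine le_csInf ⟨_, q, hq, rfl⟩ ?_
    rintro r ⟨p, hp, rfl⟩
    exact le_walkMax_of_edges hρ (fun u v huv => (hle u v).trans (spDist_le_of_adj hw huv)) p
end

section
/- Let (G,w) be a nonempty weighted graph. If the weight w is pseudoultrametrizable, then for every cycle C ⊆ G there exist at least two distinct edges e₁, e₂ ∈ E(C) such that w(e₁) = w(e₂) = max_{e ∈ E(C)} w(e). -/
open scoped Classical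

open SimpleGraph

variable {V : Type*}

/-- In a graph all of whose edges have `d`-length below `M`, joined vertices have distance
below `M`. -/
theorem aux_reach {d : V → V → ℝ} (hd : IsPseudoultrametric d) (H : SimpleGraph V) (M : ℝ)
    (hH : ∀ x y, H.Adj x y → d x y < M) {u v : V} (p : H.Walk u v) : u = v ∨ d u v < M := by
  induction p with
  | nil => exact Or.inl rfl
  | cons hadj p ih =>
    right
    rcases ih with rfl | ih
    · exact hH _ _ hadj
    · exact lt_of_le_of_lt (hd.2.2.2 _ _ _) (max_lt (hH _ _ hadj) ih)

/-- if the weight `w` is pseudoultrametrizable, then every cycle of `G`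
has at least two distinct edges of maximal weight. -/
theorem pseudoultrametrizable_cycle_two_max [Nonempty V] (G : SimpleGraph V)
    (w : Sym2 V → ℝ) (hw : ∀ e ∈ G.edgeSet, 0 ≤ w e)
    (h : ∃ d : V → V → ℝ, IsPseudoultrametric d ∧ ExtendsWeight G w d) :
    ∀ (v : V) (c : G.Walk v v), c.IsCycle →
      ∃ e₁ ∈ c.edges, ∃ e₂ ∈ c.edges, e₁ ≠ e₂ ∧ w e₁ = w e₂ ∧
        ∀ e ∈ c.edges, w e ≤ w e₁ := by
  obtain ⟨d, hd, hext⟩ := h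
  intro v c hc
  have hne : c.edges ≠ [] := by
    intro h0
    have h1 := hc.three_le_length
    rw [← SimpleGraph.Walk.length_edges, h0] at h1
    simp at h1
  obtain ⟨e, he, hmax⟩ := Finset.exists_max_image c.edges.toFinset w
    (by simpa [List.toFinset_nonempty_iff] using hne)
  simp only [List.mem_toFinset] at he hmax
  by_contra hcon
  have hlt : ∀ f ∈ c.edges, f ≠ e → w f < w e := by
    intro f hf hfe
    refine lt_of_le_of_ne (hmax f hf) fun heq => hcon ?_
    exact ⟨e, he, f, hf, hfe.symm, heq.symm, hmax⟩
  let H : SimpleGraph V := SimpleGraph.fromEdgeSet {f | f ∈ c.edges}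
  have hcH : ∀ f ∈ c.edges, f ∈ H.edgeSet := by
    intro f hf
    rw [SimpleGraph.edgeSet_fromEdgeSet]
    exact ⟨hf, G.not_isDiag_of_mem_edgeSet (c.edges_subset_edgeSet hf)⟩
  induction e using Sym2.ind with
  | _ x y =>
  have hxy : G.Adj x y := c.edges_subset_edgeSet he
  obtain ⟨-, ⟨p⟩⟩ := SimpleGraph.adj_and_reachable_delete_edges_iff_exists_cycle.2
    ⟨v, c.transfer H hcH, hc.transfer hcH, by
      rw [SimpleGraph.Walk.edges_transfer]; exact he⟩
  rcases aux_reach hd _ (w s(x, y)) (fun a b hab => by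
    rw [SimpleGraph.deleteEdges_adj, SimpleGraph.fromEdgeSet_adj] at hab
    obtain ⟨⟨hab1, hab2⟩, hab3⟩ := hab
    rw [hext a b (c.edges_subset_edgeSet hab1)]
    exact hlt _ hab1 fun h => hab3 h) p with h | h
  · exact hxy.ne h
  · rw [hext x y hxy] at h
    exact lt_irrefl _ h
end

section
/- Let (G,w) be a nonempty weighted graph (not necessarily connected). If for every cycle C ⊆ G there exist at least two distinct edges e₁, e₂ ∈ E(C) with w(e₁) = w(e₂) = max_{e ∈ E(C)} w(e), then the weight w is pseudoultrametrizable, i.e., there exists a pseudoultrametric d on V(G) with d(x,y) = w({x,y}) for every edge {x,y} ∈ E(G). -/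
open scoped Classical

open SimpleGraph

variable {V : Type*}

/-- The subgraph of edges of weight at most `t`. -/
def levelGraph (G : SimpleGraph V) (w : Sym2 V → ℝ) (t : ℝ) : SimpleGraph V where
  Adj u v := G.Adj u v ∧ w s(u, v) ≤ t
  symm := ⟨fun u v h => ⟨h.1.symm, by rw [Sym2.eq_swap]; exact h.2⟩⟩
  loopless := ⟨fun u h => G.loopless.irrefl u h.1⟩

lemma levelGraph_le (G : SimpleGraph V) (w : Sym2 V → ℝ) (t : ℝ) : levelGraph G w t ≤ G :=
  fun _ _ h => h.1

lemma levelGraph_mono (G : SimpleGraph V) (w : Sym2 V → ℝ) {s t : ℝ} (h : s ≤ t) :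
    levelGraph G w s ≤ levelGraph G w t :=
  fun _ _ h' => ⟨h'.1, h'.2.trans h⟩

lemma exists_level (G : SimpleGraph V) (w : Sym2 V → ℝ) {x y : V} (p : G.Walk x y) :
    ∃ t, 0 ≤ t ∧ (levelGraph G w t).Reachable x y := by
  induction p with
  | nil => exact ⟨0, le_rfl, Reachable.refl _⟩
  | @cons a b c hab q ih =>
    obtain ⟨t, ht, hr⟩ := ih
    refine ⟨max t (w s(a, b)), le_max_of_le_left ht, ?_⟩
    have h1 : (levelGraph G w (max t (w s(a, b)))).Adj a b := ⟨hab, le_max_right _ _⟩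
    exact h1.reachable.trans (hr.mono (levelGraph_mono G w (le_max_left _ _)))

lemma level_key (G : SimpleGraph V) (w : Sym2 V → ℝ)
    (h : ∀ (v : V) (c : G.Walk v v), c.IsCycle →
      ∃ e₁ ∈ c.edges, ∃ e₂ ∈ c.edges, e₁ ≠ e₂ ∧ w e₁ = w e₂ ∧
        ∀ e ∈ c.edges, w e ≤ w e₁) {u v : V} (huv : G.Adj u v) {t : ℝ}
    (hr : (levelGraph G w t).Reachable v u) : w s(u, v) ≤ t := by
  by_contra hlt
  push Not at hlt
  obtain ⟨p, hp⟩ := hr.exists_isPath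
  have hpe : ∀ e ∈ p.edges, w e ≤ t := by
    intro e he
    have := p.edges_subset_edgeSet he
    induction e with
    | _ a b => exact this.2
  have hq : (p.mapLe (levelGraph_le G w t)).edges = p.edges := by simp
  have hqp : (p.mapLe (levelGraph_le G w t)).IsPath := by simpa using hp
  have hc := Path.cons_isCycle ⟨_, hqp⟩ huv (by
    intro hm
    have hm' : s(u, v) ∈ p.edges := by simpa using hm
    exact absurd (hpe _ hm') (not_le.mpr hlt))
  obtain ⟨e₁, h1, e₂, h2, hne, heq, hmax⟩ := h _ _ hc
  simp only [Walk.edges_cons, List.mem_cons, hq] at h1 h2 hmax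
  have hm := hmax _ (Or.inl rfl)
  have e1 : e₁ = s(u, v) := h1.resolve_right (fun hh => by linarith [hpe _ hh])
  have e2 : e₂ = s(u, v) := h2.resolve_right (fun hh => by linarith [hpe _ hh])
  exact hne (e1.trans e2.symm)

/-- if every cycle of `G` has at least two distinct edges of maximal
weight, then the weight `w` is pseudoultrametrizable (no connectedness assumed). -/
theorem cycle_two_max_pseudoultrametrizable [Nonempty V] (G : SimpleGraph V)
    (w : Sym2 V → ℝ) (hw : ∀ e ∈ G.edgeSet, 0 ≤ w e)
    (h : ∀ (v : V) (c : G.Walk v v), c.IsCycle →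
      ∃ e₁ ∈ c.edges, ∃ e₂ ∈ c.edges, e₁ ≠ e₂ ∧ w e₁ = w e₂ ∧
        ∀ e ∈ c.edges, w e ≤ w e₁) :
    ∃ d : V → V → ℝ, IsPseudoultrametric d ∧ ExtendsWeight G w d := by
  let r : V → V := fun x => (G.connectedComponentMk x).out
  have hrr : ∀ x, G.Reachable x (r x) := fun x =>
    (ConnectedComponent.exact (Quot.out_eq (G.connectedComponentMk x))).symm
  have hrc : ∀ {x y}, G.Reachable x y → r x = r y := fun {x y} hxy => by
    simp only [r, ConnectedComponent.sound hxy]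
  let L := levelGraph G w
  have hLr : ∀ {t x y}, (L t).Reachable x y → r x = r y := fun hxy =>
    hrc (hxy.mono (levelGraph_le G w _))
  let R : ℝ → V → V → Prop := fun t x y =>
    (L t).Reachable x y ∨ ((L t).Reachable x (r x) ∧ (L t).Reachable y (r y))
  have Rmono : ∀ {s t x y}, s ≤ t → R s x y → R t x y := by
    intro s t x y hst hR
    have hm : L s ≤ L t := levelGraph_mono G w hst
    exact hR.imp (fun a => a.mono hm) (fun a => ⟨a.1.mono hm, a.2.mono hm⟩)
  have Rsymm : ∀ {t x y}, R t x y → R t y x := fun hR =>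
    hR.imp (fun a => a.symm) (fun a => a.symm)
  have Rtrans : ∀ {t x y z}, R t x y → R t y z → R t x z := by
    rintro t x y z (a | ⟨a, b⟩) (c | ⟨c, e⟩)
    · exact Or.inl (a.trans c)
    · exact Or.inr ⟨by rw [hLr a]; exact a.trans c, e⟩
    · exact Or.inr ⟨a, by rw [← hLr c]; exact c.symm.trans b⟩
    · exact Or.inr ⟨a, e⟩
  have Rex : ∀ x y, ∃ t, 0 ≤ t ∧ R t x y := by
    intro x y
    obtain ⟨p⟩ := hrr x
    obtain ⟨q⟩ := hrr y
    obtain ⟨s, hs, hs'⟩ := exists_level G w p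
    obtain ⟨t, ht, ht'⟩ := exists_level G w q
    exact ⟨max s t, le_max_of_le_left hs, Or.inr
      ⟨hs'.mono (levelGraph_mono G w (le_max_left _ _)),
        ht'.mono (levelGraph_mono G w (le_max_right _ _))⟩⟩
  let S : V → V → Set ℝ := fun x y => {t | 0 ≤ t ∧ R t x y}
  have Sbdd : ∀ x y, BddBelow (S x y) := fun x y => ⟨0, fun t ht => ht.1⟩
  have Sne : ∀ x y, (S x y).Nonempty := Rex
  have Spos : ∀ x y, 0 ≤ sInf (S x y) := fun x y => Real.sInf_nonneg fun t ht => ht.1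
  refine ⟨fun x y => sInf (S x y), ⟨Spos, ?_, ?_, ?_⟩, ?_⟩
  · intro x
    exact le_antisymm (csInf_le (Sbdd x x) ⟨le_rfl, Or.inl (Reachable.refl _)⟩) (Spos x x)
  · intro x y
    have : S x y = S y x := by
      ext t
      exact ⟨fun a => ⟨a.1, Rsymm a.2⟩, fun a => ⟨a.1, Rsymm a.2⟩⟩
    simp only [this]
  · intro x y z
    refine le_of_forall_gt fun c hc => ?_
    obtain ⟨s, hs, hsc⟩ := exists_lt_of_csInf_lt (Sne x z) ((le_max_left _ _).trans_lt hc)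
    obtain ⟨t, ht, htc⟩ := exists_lt_of_csInf_lt (Sne z y) ((le_max_right _ _).trans_lt hc)
    exact (csInf_le (Sbdd x y) ⟨le_max_of_le_left hs.1,
      Rtrans (Rmono (le_max_left s t) hs.2) (Rmono (le_max_right s t) ht.2)⟩).trans_lt
      (max_lt hsc htc)
  · intro u v huv
    refine le_antisymm (csInf_le (Sbdd u v) ⟨hw _ huv, Or.inl ?_⟩) (le_csInf (Sne u v) ?_)
    · have h1 : (L (w s(u, v))).Adj u v := ⟨huv, le_rfl⟩
      exact h1.reachable
    · rintro t ⟨-, a | ⟨a, b⟩⟩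
      · exact level_key G w h huv a.symm
      · refine level_key G w h huv (b.trans ?_)
        rw [← hrc huv.reachable]
        exact a.symm
end

section
/- Let (G,w) be a nonempty connected weighted graph whose weight w is pseudoultrametrizable. Then the subdominant pseudoultrametric ρ_w extends w, i.e., ρ_w(u,v) = w({u,v}) for every edge {u,v} ∈ E(G). -/
open scoped Classical

open SimpleGraph

variable {V : Type*}

theorem le_walkMax_aux {G : SimpleGraph V} (w : Sym2 V → ℝ) (d : V → V → ℝ)
    (hd : IsPseudoultrametric d) (he : ExtendsWeight G w d) {x y : V} (p : G.Walk x y) :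
    d x y ≤ walkMax w p := by
  induction p with
  | nil => simp [walkMax, hd.2.1]
  | @cons a b c hab q ih =>
    have h1 := hd.2.2.2 a c b
    have h2 := he a b hab
    have h3 : walkMax w (Walk.cons hab q) = max (w s(a, b)) (walkMax w q) := by
      simp [walkMax]
    rw [h3, ← h2]
    exact h1.trans (max_le_max le_rfl ih)

/-- for a connected graph with pseudoultrametrizable weight, the
subdominant pseudoultrametric `ρ_w` extends `w`. -/
theorem rho_extends [Nonempty V] (G : SimpleGraph V) (hG : G.Connected)
    (w : Sym2 V → ℝ) (hw : ∀ e ∈ G.edgeSet, 0 ≤ w e)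
    (h : ∃ d : V → V → ℝ, IsPseudoultrametric d ∧ ExtendsWeight G w d) :
    ExtendsWeight G w (rho G w) := by
  obtain ⟨d, hd, he⟩ := h
  intro u v huv
  have hne : u ≠ v := huv.ne
  rw [rho, if_neg hne]
  apply IsLeast.csInf_eq
  refine ⟨⟨huv.toWalk, ?_, ?_⟩, ?_⟩
  · simp [SimpleGraph.Adj.toWalk, hne]
  · have := hw s(u, v) huv
    simp [walkMax, SimpleGraph.Adj.toWalk, this]
  · rintro r ⟨p, -, rfl⟩
    rw [← he u v huv]
    exact le_walkMax_aux w d hd he p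
end

section
/- Let (G,w) be a nonempty weighted graph with pseudoultrametrizable weight w. If G is connected, then the subdominant pseudoultrametric ρ_w is the greatest element of the poset (𝔘_w, ⪯): ρ_w ∈ 𝔘_w and ρ(x,y) ≤ ρ_w(x,y) for every ρ ∈ 𝔘_w and all x,y ∈ V(G). -/
open scoped Classical

open SimpleGraph

variable {V : Type*}

theorem le_rho {G : SimpleGraph V} (hG : G.Connected) (w : Sym2 V → ℝ) {x y : V} {r : ℝ}
    (h : ∀ p : G.Walk x y, r ≤ walkMax w p) : r ≤ rho G w x y := by
  unfold rho
  split_ifs with hxy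
  · subst hxy
    simpa [walkMax] using h SimpleGraph.Walk.nil
  · obtain ⟨p⟩ := hG.preconnected x y
    refine le_csInf ⟨_, p.bypass, p.bypass_isPath, rfl⟩ ?_
    rintro _ ⟨q, _, rfl⟩
    exact h q

theorem le_walkMax_of_extends {G : SimpleGraph V} (w : Sym2 V → ℝ) {ρ : V → V → ℝ}
    (h : IsPseudoultrametric ρ) (he : ExtendsWeight G w ρ) {x y : V} (p : G.Walk x y) :
    ρ x y ≤ walkMax w p := by
  induction p with
  | nil => rw [h.2.1]; exact walkMax_nonneg w _
  | @cons u v t huv q ih =>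
    refine (h.2.2.2 _ _ v).trans ?_
    rw [he _ _ huv]
    have hc : walkMax w (SimpleGraph.Walk.cons huv q) = max (w s(u, v)) (walkMax w q) := by
      simp [walkMax]
    rw [hc]
    exact max_le_max le_rfl ih

/-- for a connected graph with pseudoultrametrizable weight `w`, the
subdominant pseudoultrametric `ρ_w` is the greatest element of `(𝔘_w, ⪯)`. -/
theorem rho_greatest [Nonempty V] (G : SimpleGraph V) (hG : G.Connected)
    (w : Sym2 V → ℝ) (hw : ∀ e ∈ G.edgeSet, 0 ≤ w e)
    (h : ∃ d : V → V → ℝ, IsPseudoultrametric d ∧ ExtendsWeight G w d) :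
    (IsPseudoultrametric (rho G w) ∧ ExtendsWeight G w (rho G w)) ∧
    ∀ ρ : V → V → ℝ, IsPseudoultrametric ρ → ExtendsWeight G w ρ →
      ∀ x y : V, ρ x y ≤ rho G w x y := by
  have hgreat : ∀ ρ : V → V → ℝ, IsPseudoultrametric ρ → ExtendsWeight G w ρ →
      ∀ x y : V, ρ x y ≤ rho G w x y := fun ρ h1 h2 x y =>
    le_rho hG w fun p => le_walkMax_of_extends w h1 h2 p
  refine ⟨⟨⟨fun x y => le_rho hG w fun p => walkMax_nonneg w p, fun x => by simp [rho], ?_, ?_⟩,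
    ?_⟩, hgreat⟩
  · have key : ∀ x y, rho G w x y ≤ rho G w y x := fun x y => le_rho hG w fun p => by
      refine (rho_le_walkMax w p.reverse).trans ?_
      have hp := (walkMax_le_iff w p _).1 le_rfl
      exact (walkMax_le_iff w _ _).2 ⟨hp.1, fun e he => hp.2 e (by simpa using he)⟩
    exact fun x y => le_antisymm (key x y) (key y x)
  · intro x y z
    by_contra! hlt
    obtain ⟨h1, h2⟩ := max_lt_iff.1 hlt
    have e1 : ∃ p : G.Walk x z, walkMax w p < rho G w x y := by
      by_contra! hc
      exact absurd (le_rho hG w hc) (not_le.2 h1)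
    have e2 : ∃ p : G.Walk z y, walkMax w p < rho G w x y := by
      by_contra! hc
      exact absurd (le_rho hG w hc) (not_le.2 h2)
    obtain ⟨p, hp⟩ := e1
    obtain ⟨q, hq⟩ := e2
    have h3 : walkMax w (p.append q) ≤ max (walkMax w p) (walkMax w q) := by
      have hp := (walkMax_le_iff w p _).1 le_rfl
      have hq := (walkMax_le_iff w q _).1 le_rfl
      refine (walkMax_le_iff w _ _).2 ⟨le_max_of_le_left hp.1, fun e he => ?_⟩
      rw [SimpleGraph.Walk.edges_append, List.mem_append] at he
      rcases he with he | he
      · exact le_max_of_le_left (hp.2 e he)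
      · exact le_max_of_le_right (hq.2 e he)
    exact absurd ((rho_le_walkMax w (p.append q)).trans h3) (not_le.2 (max_lt hp hq))
  · intro u v huv
    obtain ⟨d, hd, hdw⟩ := h
    apply le_antisymm
    · refine (rho_le_walkMax w huv.toWalk).trans ?_
      refine (walkMax_le_iff w _ _).2 ⟨hw _ huv, fun e he => ?_⟩
      have : e = s(u, v) := by simpa using he
      rw [this]
    · rw [← hdw u v huv]
      exact hgreat d hd hdw u v
end

section
/- Let (G,w) be a nonempty weighted graph. If the poset (𝔘_w, ⪯) has a greatest element, i.e., there exists a pseudoultrametric ρ* extending w such that ρ(x,y) ≤ ρ*(x,y) for every pseudoultrametric ρ extending w and all x,y ∈ V(G), then G is connected. -/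
open scoped Classical

open SimpleGraph

variable {V : Type*}

/-- if `(𝔘_w, ⪯)` has a greatest element, then `G` is connected. -/
theorem greatest_implies_connected [Nonempty V] (G : SimpleGraph V)
    (w : Sym2 V → ℝ) (hw : ∀ e ∈ G.edgeSet, 0 ≤ w e)
    (h : ∃ ρgr : V → V → ℝ, IsPseudoultrametric ρgr ∧ ExtendsWeight G w ρgr ∧
      ∀ ρ : V → V → ℝ, IsPseudoultrametric ρ → ExtendsWeight G w ρ →
        ∀ x y : V, ρ x y ≤ ρgr x y) :
    G.Connected := by
  obtain ⟨d, ⟨h0, hr, hs, ht⟩, he, hg⟩ := h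
  rw [connected_iff]
  refine ⟨?_, inferInstance⟩
  intro a b
  by_contra hab
  -- raise the distance between different components above `d a b`
  have key := hg (fun x y => if G.Reachable x y then d x y else max (d x y) (d a b + 1))
    ⟨?_, ?_, ?_, ?_⟩ ?_ a b
  · simp only [hab, if_false] at key
    have := le_max_right (d a b) (d a b + 1)
    linarith
  · intro x y
    dsimp only
    split_ifs
    · exact h0 x y
    · exact le_max_of_le_left (h0 x y)
  · intro x
    simp [hr]
  · intro x y
    simp only [hs x y, reachable_comm (u := x) (v := y)]
  · have hle : ∀ x y, d x y ≤ if G.Reachable x y then d x y else max (d x y) (d a b + 1) := by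
      intro x y
      split_ifs
      · exact le_rfl
      · exact le_max_left _ _
    intro x y z
    have h1 := (ht x y z).trans (max_le_max (hle x z) (hle z y))
    dsimp only
    by_cases hxy : G.Reachable x y
    · rw [if_pos hxy]
      exact h1
    · rw [if_neg hxy]
      refine max_le h1 ?_
      by_cases hxz : G.Reachable x z
      · have hzy : ¬ G.Reachable z y := fun h => hxy (hxz.trans h)
        rw [if_neg hzy]
        exact le_max_of_le_right (le_max_right _ _)
      · rw [if_neg hxz]
        exact le_max_of_le_left (le_max_right _ _)
  · intro u v huv
    simp only [huv.reachable, if_true]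
    exact he u v huv
end

section
/- Let G be a nonempty graph. Then G is connected if and only if for every pseudoultrametrizable weight w : E(G) → [0,∞) the poset (𝔘_w, ⪯) has a greatest element. -/
open scoped Classical

open SimpleGraph

variable {V : Type*}

theorem walk_bound {G : SimpleGraph V} (w : Sym2 V → ℝ) {x y : V} (p : G.Walk x y) :
    ∃ M : ℝ, ∀ ρ : V → V → ℝ, IsPseudoultrametric ρ → ExtendsWeight G w ρ → ρ x y ≤ M := by
  induction p with
  | nil => exact ⟨0, fun ρ h _ => (h.2.1 _).le⟩
  | @cons u v t h p ih =>
    obtain ⟨M, hM⟩ := ih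
    refine ⟨max (w s(u, v)) M, fun ρ h1 h2 => ?_⟩
    exact (h1.2.2.2 u t v).trans (max_le_max (h2 u v h).le (hM ρ h1 h2))

/-- `G` is connected iff for every pseudoultrametrizable weight `w` the
poset `(𝔘_w, ⪯)` has a greatest element. -/
theorem connected_iff_greatest [Nonempty V] (G : SimpleGraph V) :
    G.Connected ↔
      ∀ w : Sym2 V → ℝ, (∀ e ∈ G.edgeSet, 0 ≤ w e) →
        (∃ d : V → V → ℝ, IsPseudoultrametric d ∧ ExtendsWeight G w d) →
        ∃ ρgr : V → V → ℝ, IsPseudoultrametric ρgr ∧ ExtendsWeight G w ρgr ∧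
          ∀ ρ : V → V → ℝ, IsPseudoultrametric ρ → ExtendsWeight G w ρ →
            ∀ x y : V, ρ x y ≤ ρgr x y := by
  constructor
  · rintro hG w - ⟨d, hd, hdw⟩
    let U := {ρ : V → V → ℝ // IsPseudoultrametric ρ ∧ ExtendsWeight G w ρ}
    haveI : Nonempty U := ⟨⟨d, hd, hdw⟩⟩
    have hb : ∀ x y, BddAbove (Set.range fun ρ : U => ρ.1 x y) := by
      intro x y
      obtain ⟨p⟩ := hG.preconnected x y
      obtain ⟨M, hM⟩ := walk_bound w p
      exact ⟨M, by rintro _ ⟨ρ, rfl⟩; exact hM ρ.1 ρ.2.1 ρ.2.2⟩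
    have hle : ∀ (ρ : U) x y, ρ.1 x y ≤ ⨆ ρ : U, ρ.1 x y := fun ρ x y => le_ciSup (hb x y) ρ
    refine ⟨fun x y => ⨆ ρ : U, ρ.1 x y, ⟨?_, ?_, ?_, ?_⟩, ?_, ?_⟩
    · intro x y
      exact (hd.1 x y).trans (hle ⟨d, hd, hdw⟩ x y)
    · intro x
      have : ∀ ρ : U, ρ.1 x x = 0 := fun ρ => ρ.2.1.2.1 x
      simp [this]
    · intro x y
      exact congrArg iSup (funext fun ρ : U => ρ.2.1.2.2.1 x y)
    · intro x y z
      exact ciSup_le fun ρ => (ρ.2.1.2.2.2 x y z).trans (max_le_max (hle ρ x z) (hle ρ z y))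
    · intro u v h
      have : ∀ ρ : U, ρ.1 u v = w s(u, v) := fun ρ => ρ.2.2 u v h
      simp [this]
    · intro ρ h1 h2 x y
      exact hle ⟨ρ, h1, h2⟩ x y
  · intro H
    have key : ∀ k : ℝ, 0 ≤ k →
        IsPseudoultrametric (fun u v : V => if G.Reachable u v then (0 : ℝ) else k) ∧
        ExtendsWeight G (fun _ => 0) (fun u v : V => if G.Reachable u v then (0 : ℝ) else k) := by
      intro k hk
      refine ⟨⟨?_, ?_, ?_, ?_⟩, ?_⟩
      · intro x y
        dsimp only
        split_ifs <;> simp [hk]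
      · intro x
        simp
      · intro x y
        simp only [SimpleGraph.reachable_comm]
      · intro x y z
        dsimp only
        by_cases h1 : G.Reachable x z
        · by_cases h2 : G.Reachable z y
          · simp [h1, h2, h1.trans h2]
          · rw [if_neg h2]
            split_ifs <;> simp [hk]
        · rw [if_neg h1]
          split_ifs <;> simp [hk]
      · intro u v h
        simp [h.reachable]
    obtain ⟨g, hg, -, hmax⟩ := H (fun _ => 0) (fun _ _ => le_rfl) ⟨_, key 0 le_rfl⟩
    refine ⟨fun x y => ?_⟩
    by_contra hxy
    have h0 := hg.1 x y
    have hk := key (g x y + 1) (by linarith)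
    have := hmax _ hk.1 hk.2 x y
    simp only [if_neg hxy] at this
    linarith
end

section
/- Let G be a nonempty graph. Then G is a tree if and only if every weight w : E(G) → [0,∞) is pseudoultrametrizable and for every such w the poset (𝔘_w, ⪯) contains a greatest element. -/
open scoped Classical

open SimpleGraph

variable {V : Type*}

theorem ultra_le_walkMax {G : SimpleGraph V} (w : Sym2 V → ℝ) {ρ : V → V → ℝ}
    (hρ : IsPseudoultrametric ρ) (he : ExtendsWeight G w ρ) {x y : V} (p : G.Walk x y) :
    ρ x y ≤ walkMax w p := by
  induction p with
  | nil => simp [walkMax, hρ.2.1]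
  | cons h p ih =>
    refine (hρ.2.2.2 _ _ _).trans (max_le_max (he _ _ h).le ih)

theorem tree_greatest (G : SimpleGraph V) (hc : G.Connected) (ha : G.IsAcyclic)
    (w : Sym2 V → ℝ) (hw : ∀ e ∈ G.edgeSet, 0 ≤ w e) :
    ∃ ρgr : V → V → ℝ, IsPseudoultrametric ρgr ∧ ExtendsWeight G w ρgr ∧
      ∀ ρ : V → V → ℝ, IsPseudoultrametric ρ → ExtendsWeight G w ρ →
        ∀ x y : V, ρ x y ≤ ρgr x y := by
  have hP : ∀ x y, ∃ p : G.Walk x y, p.IsPath := fun x y =>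
    ⟨(hc.preconnected x y).some.bypass, SimpleGraph.Walk.bypass_isPath _⟩
  choose P hP using hP
  have hsub : ∀ {x y : V} (q : G.Walk x y), (P x y).edges ⊆ q.edges := by
    intro x y q
    have h := ha.path_unique ⟨P x y, hP x y⟩ ⟨q.bypass, q.bypass_isPath⟩
    have h2 : P x y = q.bypass := congrArg Subtype.val h
    rw [h2]
    exact q.edges_bypass_subset_edges
  have hle : ∀ {x y : V} (q : G.Walk x y), walkMax w (P x y) ≤ walkMax w q := by
    intro x y q
    have := (walkMax_le_iff w q _).1 le_rfl
    exact (walkMax_le_iff _ _ _).2 ⟨this.1, fun e he => this.2 e (hsub q he)⟩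
  have h0 : ∀ {x y : V} (q : G.Walk x y), 0 ≤ walkMax w q :=
    fun q => ((walkMax_le_iff w q _).1 le_rfl).1
  have hrev : ∀ x y, walkMax w (P x y) ≤ walkMax w (P y x) := by
    intro x y
    refine (hle (P y x).reverse).trans ?_
    rw [walkMax_le_iff]
    refine ⟨h0 _, fun e he => ?_⟩
    rw [SimpleGraph.Walk.edges_reverse, List.mem_reverse] at he
    exact ((walkMax_le_iff w (P y x) _).1 le_rfl).2 e he
  have hU : IsPseudoultrametric (fun x y => walkMax w (P x y)) := by
    refine ⟨fun x y => h0 _, fun x => ?_, fun x y => le_antisymm (hrev _ _) (hrev _ _),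
      fun x y z => ?_⟩
    · exact le_antisymm ((hle SimpleGraph.Walk.nil).trans (by simp [walkMax])) (h0 _)
    · refine (hle ((P x z).append (P z y))).trans ?_
      rw [walkMax_le_iff]
      refine ⟨le_max_of_le_left (h0 _), fun e he => ?_⟩
      rw [SimpleGraph.Walk.edges_append, List.mem_append] at he
      rcases he with he | he
      · exact le_max_of_le_left (((walkMax_le_iff w _ _).1 le_rfl).2 e he)
      · exact le_max_of_le_right (((walkMax_le_iff w _ _).1 le_rfl).2 e he)
  refine ⟨fun x y => walkMax w (P x y), hU, ?_, fun ρ h1 h2 x y => ultra_le_walkMax w h1 h2 _⟩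
  intro u v huv
  have hb := isBridge_iff_forall_walk_mem_edges.1 (isAcyclic_iff_forall_adj_isBridge.1 ha huv)
  refine le_antisymm ((hle huv.toWalk).trans ?_)
    (((walkMax_le_iff w _ _).1 le_rfl).2 _ (hb (P u v)))
  have := hw s(u, v) huv
  simp [walkMax_le_iff, this]

/-- `G` is a tree iff every weight `w` is pseudoultrametrizable and for
every such `w` the poset `(𝔘_w, ⪯)` has a greatest element. -/
theorem tree_iff [Nonempty V] (G : SimpleGraph V) :
    (G.Connected ∧ G.IsAcyclic) ↔
      ∀ w : Sym2 V → ℝ, (∀ e ∈ G.edgeSet, 0 ≤ w e) →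
        (∃ d : V → V → ℝ, IsPseudoultrametric d ∧ ExtendsWeight G w d) ∧
        ∃ ρgr : V → V → ℝ, IsPseudoultrametric ρgr ∧ ExtendsWeight G w ρgr ∧
          ∀ ρ : V → V → ℝ, IsPseudoultrametric ρ → ExtendsWeight G w ρ →
            ∀ x y : V, ρ x y ≤ ρgr x y := by
  constructor
  · rintro ⟨hc, ha⟩ w hw
    obtain ⟨d, h1, h2, h3⟩ := tree_greatest G hc ha w hw
    exact ⟨⟨d, h1, h2⟩, d, h1, h2, h3⟩
  · intro H
    constructor
    · refine ⟨fun x y => ?_⟩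
      by_contra hxy
      obtain ⟨-, ρ, h1, h2, h3⟩ := H (fun _ => 0) (fun _ _ => le_rfl)
      have hpos := h1.1 x y
      have := h3 (fun u v => if G.Reachable u v then 0 else ρ x y + 1) ?_ ?_ x y
      · simp only [if_neg hxy] at this
        linarith
      · refine ⟨fun u v => ?_, fun u => ?_, fun u v => ?_, fun u v z => ?_⟩
        · dsimp only
          split_ifs <;> linarith
        · simp
        · simp only [SimpleGraph.reachable_comm]
        · by_cases ha : G.Reachable u z
          · by_cases hb : G.Reachable z v
            · simp [ha, hb, ha.trans hb]
            · simp only [if_neg hb]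
              apply le_max_of_le_right
              split_ifs <;> linarith
          · simp only [if_neg ha]
            apply le_max_of_le_left
            split_ifs <;> linarith
      · intro u v huv
        simp [huv.reachable]
    · rw [isAcyclic_iff_forall_adj_isBridge]
      intro u v huv
      rw [isBridge_iff_forall_walk_mem_edges]
      intro p
      by_contra hp
      obtain ⟨⟨d, h1, h2⟩, -⟩ := H (fun e => if e = s(u, v) then 1 else 0)
        (fun e _ => by split_ifs <;> norm_num)
      have h4 := h2 u v huv
      have h5 := ultra_le_walkMax _ h1 h2 p
      have h6 : walkMax (fun e => if e = s(u, v) then (1 : ℝ) else 0) p ≤ 0 := by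
        rw [walkMax_le_iff]
        refine ⟨le_rfl, fun e he => ?_⟩
        have : e ≠ s(u, v) := fun h => hp (h ▸ he)
        simp [this]
      simp only [if_true] at h4
      linarith
end

section
/- Let G be a complete k-partite graph with k ≥ 2 and let w : E(G) → [0,∞) be a pseudoultrametrizable weight. Define ρ_{0,w} on V(G) × V(G) by: ρ_{0,w}(u,u) = 0; for distinct u, v, ρ_{0,w}(u,v) = 0 if {u,v} ∈ TM, and ρ_{0,w}(u,v) = max_{e ∈ E(F)} w(e) otherwise, where F is any path joining u and v on which the maximal weight is attained at exactly one edge (this value is independent of the choice of such F, and for adjacent u,v the single-edge path gives ρ_{0,w}(u,v) = w({u,v})). Then ρ_{0,w} is well defined, is a pseudoultrametric extending w, and is the least element of (𝔘_w, ⪯): ρ_{0,w}(u,v) ≤ ρ(u,v) for every ρ ∈ 𝔘_w and all u,v ∈ V(G). -/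
open scoped Classical

open SimpleGraph

variable {V : Type*}

/-- `G` is complete multipartite with parts `S`: `S` is a family of nonempty pairwise
disjoint sets covering `V`, and two vertices are adjacent iff they lie in different
parts. The number of parts is the cardinality of `S`. -/
def IsCompleteMultipartiteWith (G : SimpleGraph V) (S : Set (Set V)) : Prop :=
  (∀ A ∈ S, A.Nonempty) ∧
  (∀ A ∈ S, ∀ B ∈ S, A ≠ B → Disjoint A B) ∧
  (∀ v : V, ∃ A ∈ S, v ∈ A) ∧
  ∀ u v : V, G.Adj u v ↔ ∃ A ∈ S, ∃ B ∈ S, A ≠ B ∧ u ∈ A ∧ v ∈ B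

/-- The maximal weight on the path `F` is attained at exactly one edge. -/
def UniqueMaxEdge {G : SimpleGraph V} (w : Sym2 V → ℝ) {u v : V} (F : G.Walk u v) : Prop :=
  ∃ e₀ ∈ F.edges, (∀ e ∈ F.edges, w e ≤ w e₀) ∧ ∀ e ∈ F.edges, w e = w e₀ → e = e₀

/-- `{u, v}` belongs to `TM`: `u`, `v` are distinct nonadjacent vertices such that every
path joining them contains at least two distinct edges of maximal weight. -/
def TM (G : SimpleGraph V) (w : Sym2 V → ℝ) (u v : V) : Prop :=
  u ≠ v ∧ ¬G.Adj u v ∧ ∀ F : G.Walk u v, F.IsPath →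
    ∃ e₁ ∈ F.edges, ∃ e₂ ∈ F.edges, e₁ ≠ e₂ ∧ w e₁ = w e₂ ∧ ∀ e ∈ F.edges, w e ≤ w e₁

/-- `e₀` is the strict maximum on the walk. -/
def SMax {G : SimpleGraph V} (w : Sym2 V → ℝ) {u v : V} (F : G.Walk u v) (e₀ : Sym2 V) : Prop :=
  e₀ ∈ F.edges ∧ ∀ e ∈ F.edges, e ≠ e₀ → w e < w e₀

theorem uniqueMaxEdge_iff {G : SimpleGraph V} (w : Sym2 V → ℝ) {u v : V} (F : G.Walk u v) :
    UniqueMaxEdge w F ↔ ∃ e₀, SMax w F e₀ := by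
  constructor
  · rintro ⟨e₀, h, h1, h2⟩
    exact ⟨e₀, h, fun e he hne => lt_of_le_of_ne (h1 e he) (fun h => hne (h2 e he h))⟩
  · rintro ⟨e₀, h, h1⟩
    refine ⟨e₀, h, fun e he => ?_, fun e he heq => ?_⟩
    · by_cases hh : e = e₀
      · rw [hh]
      · exact (h1 e he hh).le
    · by_contra hh
      exact absurd heq (h1 e he hh).ne

theorem foldr_max_eq (l : List ℝ) (m : ℝ) (hm : m ∈ l) (h0 : 0 ≤ m) (h : ∀ x ∈ l, x ≤ m) :
    l.foldr max 0 = m := by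
  apply le_antisymm
  · clear hm
    induction l with
    | nil => simpa using h0
    | cons a l ih =>
      simp only [List.foldr_cons]
      exact max_le (h a (by simp)) (ih (fun x hx => h x (by simp [hx])))
  · clear h
    induction l with
    | nil => simp at hm
    | cons a l ih =>
      simp only [List.foldr_cons]
      rcases List.mem_cons.1 hm with h | h
      · exact h ▸ le_max_left _ _
      · exact (ih h).trans (le_max_right _ _)

theorem SMax.walkMax_eq {G : SimpleGraph V} {w : Sym2 V → ℝ} (hw : ∀ e ∈ G.edgeSet, 0 ≤ w e)
    {u v : V} {F : G.Walk u v} {e₀ : Sym2 V} (h : SMax w F e₀) : walkMax w F = w e₀ := by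
  refine foldr_max_eq _ _ (List.mem_map_of_mem h.1) (hw _ (F.edges_subset_edgeSet h.1)) ?_
  intro x hx
  obtain ⟨e, he, rfl⟩ := List.mem_map.1 hx
  by_cases hh : e = e₀
  · rw [hh]
  · exact (h.2 e he hh).le

theorem SMax.not_TM {G : SimpleGraph V} {w : Sym2 V → ℝ}
    {u v : V} {F : G.Walk u v} {e₀ : Sym2 V} (h : SMax w F e₀) (hF : F.IsPath) :
    ¬ TM G w u v := by
  rintro ⟨_, _, h3⟩
  obtain ⟨e₁, h1, e₂, h2, hne, heq, hm⟩ := h3 F hF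
  have a1 : e₁ = e₀ := by
    by_contra hh
    exact absurd (hm _ h.1) (not_le.2 (h.2 _ h1 hh))
  have a2 : e₂ = e₀ := by
    by_contra hh
    exact absurd (hm _ h.1) (not_le.2 (heq ▸ h.2 _ h2 hh))
  exact hne (a1.trans a2.symm)

theorem dist_lt {G : SimpleGraph V} {w : Sym2 V → ℝ} {d : V → V → ℝ}
    (hd : IsPseudoultrametric d) (hex : ExtendsWeight G w d) (c : ℝ)
    {u v : V} (F : G.Walk u v) (h : ∀ e ∈ F.edges, w e < c) : u = v ∨ d u v < c := by
  obtain ⟨d0, d1, d2, d3⟩ := hd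
  induction F with
  | nil => exact Or.inl rfl
  | @cons u t v hadj p ih =>
    right
    have h1 : d u t < c := by
      rw [hex u t hadj]; exact h _ (by simp)
    rcases ih (fun e he => h e (by simp [he])) with rfl | h2
    · exact h1
    · exact (d3 u v t).trans_lt (max_lt h1 h2)

theorem SMax.dist_eq {G : SimpleGraph V} {w : Sym2 V → ℝ} {d : V → V → ℝ}
    (hd : IsPseudoultrametric d) (hex : ExtendsWeight G w d) {e₀ : Sym2 V}
    {u v : V} {F : G.Walk u v} (hF : F.IsPath) (h : SMax w F e₀) : d u v = w e₀ := by
  have hd' := hd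
  obtain ⟨d0, d1, d2, d3⟩ := hd
  induction F with
  | nil => simp [SMax] at h
  | @cons u t v hadj p ih =>
    have hnot : s(u, t) ∉ p.edges := by
      have := hF.isTrail.edges_nodup
      simp only [Walk.edges_cons, List.nodup_cons] at this
      exact this.1
    have hut := hex u t hadj
    obtain ⟨hm, hl⟩ := h
    simp only [Walk.edges_cons, List.mem_cons] at hm hl
    rcases hm with rfl | hm
    · have := dist_lt hd' hex (w s(u,t)) p
        (fun e he => hl e (Or.inr he) (fun hh => hnot (hh ▸ he)))
      rcases this with rfl | h2
      · exact hut
      · have a := d3 u v t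
        have b := d3 u t v
        rw [d2 v t] at b
        rcases le_max_iff.1 b with b | b <;> rcases le_max_iff.1 a with a | a <;> linarith
    · have h1 := ih (hF.of_cons) ⟨hm, fun e he => hl e (Or.inr he)⟩
      have h2 := hl s(u,t) (Or.inl rfl) (fun hh => hnot (hh ▸ hm))
      have a := d3 u v t
      have b := d3 t v u
      rw [d2 t u] at b
      rcases le_max_iff.1 b with b | b <;> rcases le_max_iff.1 a with a | a <;> linarith

theorem exists_smax {G : SimpleGraph V} {w : Sym2 V → ℝ} {u v : V} (hne : u ≠ v)
    (h : ¬ TM G w u v) : ∃ F : G.Walk u v, F.IsPath ∧ ∃ e₀, SMax w F e₀ := by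
  by_cases hadj : G.Adj u v
  · exact ⟨hadj.toWalk, by simp [hne], s(u,v), by simp [SMax]⟩
  · simp only [TM, not_and, not_forall] at h
    obtain ⟨F, hF, h⟩ := h hne hadj
    refine ⟨F, hF, ?_⟩
    have hnon : F.edges.toFinset.Nonempty := by
      cases F with
      | nil => exact absurd rfl hne
      | cons h p => exact ⟨s(_, _), by simp; exact Or.inl (Or.inl ⟨rfl, rfl⟩)⟩
    obtain ⟨e₀, he₀, hmax⟩ := Finset.exists_max_image _ w hnon
    simp only [List.mem_toFinset] at he₀ hmax
    refine ⟨e₀, he₀, fun e he hee => lt_of_le_of_ne (hmax e he) fun heq => h ?_⟩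
    exact ⟨e₀, he₀, e, he, hee.symm, heq.symm, hmax⟩

theorem SMax.reverse {G : SimpleGraph V} {w : Sym2 V → ℝ}
    {u v : V} {F : G.Walk u v} {e₀ : Sym2 V} (h : SMax w F e₀) : SMax w F.reverse e₀ := by
  simpa [SMax] using h

theorem TM.symm {G : SimpleGraph V} {w : Sym2 V → ℝ} {u v : V} (h : TM G w u v) :
    TM G w v u := by
  by_contra hh
  obtain ⟨F, hF, e₀, he⟩ := exists_smax h.1.symm hh
  exact he.reverse.not_TM hF.reverse h

theorem transfer {G : SimpleGraph V} {w : Sym2 V → ℝ}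
    (hG : ∀ x z t, ¬ G.Adj x z → G.Adj x t → G.Adj z t)
    {x y z : V} (hT : TM G w x z) {F : G.Walk x y} (hF : F.IsPath) {e₀ : Sym2 V}
    (h : SMax w F e₀) : ∃ F' : G.Walk z y, F'.IsPath ∧ ∃ e', SMax w F' e' ∧ w e' = w e₀ := by
  by_cases hz : z ∈ F.support
  · have hE : F.edges = (F.takeUntil z hz).edges ++ (F.dropUntil z hz).edges := by
      rw [← Walk.edges_append, Walk.take_spec]
    refine ⟨F.dropUntil z hz, hF.dropUntil hz, e₀, ⟨?_, ?_⟩, rfl⟩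
    · have h1 := h.1
      rw [hE, List.mem_append] at h1
      refine h1.resolve_left fun h1 => ?_
      have : SMax w (F.takeUntil z hz) e₀ :=
        ⟨h1, fun e he => h.2 e (by rw [hE]; simp [he])⟩
      exact this.not_TM (hF.takeUntil hz) hT
    · exact fun e he => h.2 e (by rw [hE]; simp [he])
  · cases F with
    | nil => simp [SMax] at h
    | @cons _ t _ hadj p =>
      have hzt := hG x z t hT.2.1 hadj
      have hweq : w s(x,t) = w s(z,t) := by
        let Q : G.Walk x z := Walk.cons hadj (Walk.cons hzt.symm Walk.nil)
        obtain ⟨e₁, h1, e₂, h2, hne, heq, -⟩ := hT.2.2 Q (by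
          simp [Q, Walk.cons_isPath_iff, hadj.ne, hzt.ne.symm, hT.1])
        simp only [Q, Walk.edges_cons, Walk.edges_nil, List.mem_cons, List.not_mem_nil,
          or_false] at h1 h2
        rw [Sym2.eq_swap (a := z)]
        rcases h1 with rfl | rfl <;> rcases h2 with rfl | rfl
        · exact absurd rfl hne
        · exact heq
        · exact heq.symm
        · exact absurd rfl hne
      have hnot : s(x, t) ∉ p.edges := by
        have := hF.isTrail.edges_nodup
        simp only [Walk.edges_cons, List.nodup_cons] at this
        exact this.1
      have hzp : z ∉ p.support := fun hh => hz (by simp [hh])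
      refine ⟨Walk.cons hzt p, (Walk.cons_isPath_iff _ _).2 ⟨hF.of_cons, hzp⟩, ?_⟩
      obtain ⟨hm, hl⟩ := h
      simp only [Walk.edges_cons, List.mem_cons] at hm hl
      rcases hm with rfl | hm
      · refine ⟨s(z,t), ⟨by simp, ?_⟩, hweq.symm⟩
        intro e he hne
        simp only [Walk.edges_cons, List.mem_cons] at he
        rw [← hweq]
        have he := he.resolve_left hne
        exact hl e (Or.inr he) (fun hh => hnot (hh ▸ he))
      · refine ⟨e₀, ⟨by simp [hm], ?_⟩, rfl⟩
        intro e he hne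
        simp only [Walk.edges_cons, List.mem_cons] at he
        rcases he with rfl | he
        · rw [← hweq]
          exact hl _ (Or.inl rfl) (fun hh => hnot (hh ▸ hm))
        · exact hl e (Or.inr he) hne

/-- for a complete k-partite graph (`k ≥ 2`) and a pseudoultrametrizable
weight `w`, the function `ρ_{0,w}` of (eq. 21.2) is well defined (any two admissible
paths give the same value), and any function `ρ₀` satisfying its defining clauses is a
pseudoultrametric extending `w` (in particular `ρ₀ u v = w {u,v}` on edges) and is the
least element of `(𝔘_w, ⪯)`. -/
theorem least_element_formula [Nonempty V] (G : SimpleGraph V)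
    (S : Set (Set V)) (hS : IsCompleteMultipartiteWith G S)
    (hk : ∃ A ∈ S, ∃ B ∈ S, A ≠ B)
    (w : Sym2 V → ℝ) (hw : ∀ e ∈ G.edgeSet, 0 ≤ w e)
    (hpu : ∃ d : V → V → ℝ, IsPseudoultrametric d ∧ ExtendsWeight G w d) :
    (∀ u v : V, u ≠ v → ¬TM G w u v →
      (∃ F : G.Walk u v, F.IsPath ∧ UniqueMaxEdge w F) ∧
      ∀ F₁ F₂ : G.Walk u v, F₁.IsPath → F₂.IsPath →
        UniqueMaxEdge w F₁ → UniqueMaxEdge w F₂ → walkMax w F₁ = walkMax w F₂) ∧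
    ∀ ρ₀ : V → V → ℝ,
      (∀ u : V, ρ₀ u u = 0) →
      (∀ u v : V, u ≠ v → TM G w u v → ρ₀ u v = 0) →
      (∀ u v : V, u ≠ v → ¬TM G w u v →
        ∀ F : G.Walk u v, F.IsPath → UniqueMaxEdge w F → ρ₀ u v = walkMax w F) →
      IsPseudoultrametric ρ₀ ∧ ExtendsWeight G w ρ₀ ∧
        ∀ ρ : V → V → ℝ, IsPseudoultrametric ρ → ExtendsWeight G w ρ →
          ∀ u v : V, ρ₀ u v ≤ ρ u v := by
  have hG : ∀ x z t, ¬ G.Adj x z → G.Adj x t → G.Adj z t := by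
    obtain ⟨_, hdis, hcov, hadj⟩ := hS
    intro x z t hxz hxt
    rw [hadj] at hxz hxt ⊢
    obtain ⟨A, hA, B, hB, hAB, hx, ht⟩ := hxt
    obtain ⟨C, hC, hz⟩ := hcov z
    by_cases hAC : A = C
    · subst hAC
      exact ⟨A, hA, B, hB, hAB, hz, ht⟩
    · exact absurd ⟨A, hA, C, hC, hAC, hx, hz⟩ hxz
  obtain ⟨d, hd, hex⟩ := hpu
  refine ⟨fun u v hne hT => ⟨?_, ?_⟩, fun ρ₀ r0 r1 r2 => ?_⟩
  · simp only [uniqueMaxEdge_iff]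
    exact exists_smax hne hT
  · intro F₁ F₂ p1 p2 u1 u2
    obtain ⟨e1, u1⟩ := (uniqueMaxEdge_iff _ _).1 u1
    obtain ⟨e2, u2⟩ := (uniqueMaxEdge_iff _ _).1 u2
    rw [u1.walkMax_eq hw, u2.walkMax_eq hw, ← u1.dist_eq hd hex p1, ← u2.dist_eq hd hex p2]
  · have key : ∀ u v, u ≠ v → ∀ F : G.Walk u v, F.IsPath → ∀ e, SMax w F e →
        ρ₀ u v = w e := fun u v hne F hF e he => by
      rw [r2 u v hne (he.not_TM hF) F hF ((uniqueMaxEdge_iff _ _).2 ⟨e, he⟩), he.walkMax_eq hw]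
    have keyd : ∀ ρ : V → V → ℝ, IsPseudoultrametric ρ → ExtendsWeight G w ρ →
        ∀ u v, ¬ TM G w u v → ρ₀ u v = ρ u v := by
      intro ρ hρ hρe u v hT
      by_cases hne : u = v
      · subst hne; rw [r0, hρ.2.1]
      · obtain ⟨F, hF, e, he⟩ := exists_smax hne hT
        rw [key u v hne F hF e he, he.dist_eq hρ hρe hF]
    have least : ∀ ρ : V → V → ℝ, IsPseudoultrametric ρ → ExtendsWeight G w ρ →
        ∀ u v, ρ₀ u v ≤ ρ u v := by
      intro ρ hρ hρe u v
      by_cases hT : TM G w u v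
      · rw [r1 u v hT.1 hT]; exact hρ.1 _ _
      · exact (keyd ρ hρ hρe u v hT).le
    have nonneg : ∀ u v, 0 ≤ ρ₀ u v := by
      intro u v
      by_cases hT : TM G w u v
      · rw [r1 u v hT.1 hT]
      · rw [keyd d hd hex u v hT]; exact hd.1 _ _
    have symm : ∀ u v, ρ₀ u v = ρ₀ v u := by
      intro u v
      by_cases hT : TM G w u v
      · rw [r1 u v hT.1 hT, r1 v u hT.1.symm hT.symm]
      · rw [keyd d hd hex u v hT, keyd d hd hex v u (fun h => hT h.symm), hd.2.2.1]
    have tri : ∀ x y z, TM G w x z → ρ₀ x y ≤ ρ₀ z y := by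
      intro x y z hT
      by_cases hxy : x = y
      · subst hxy; rw [r0]; exact nonneg _ _
      by_cases hTxy : TM G w x y
      · rw [r1 x y hxy hTxy]; exact nonneg _ _
      obtain ⟨F, hF, e, he⟩ := exists_smax hxy hTxy
      obtain ⟨F', hF', e', he', heq⟩ := transfer hG hT hF he
      have hzy : z ≠ y := by rintro rfl; exact hTxy hT
      rw [key x y hxy F hF e he, key z y hzy F' hF' e' he', heq]
    refine ⟨⟨nonneg, r0, symm, ?_⟩, ?_, least⟩
    · intro x y z
      by_cases h1 : TM G w x z
      · exact (tri x y z h1).trans (le_max_right _ _)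
      by_cases h2 : TM G w z y
      · refine le_trans ?_ (le_max_left _ _)
        rw [symm x y, symm x z]
        exact tri y x z h2.symm
      rw [keyd d hd hex x z h1, keyd d hd hex z y h2]
      exact (least d hd hex x y).trans (hd.2.2.2 x y z)
    · intro u v hadj
      rw [keyd d hd hex u v (fun h => h.2.1 hadj), hex u v hadj]
end
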